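/- Let π : 𝒳 → Spf(R) be a formal deformation of a smooth projective variety X. Sending the class [F] = [E_K] ∈ 𝒩(𝒳_K) (where E ∈ D^b(𝒳) is any lift of F) to [E₀] ∈ 𝒩(X) determines a well-defined injective linear map res : 𝒩(𝒳_K) → 𝒩(X)/ι*K(𝒳)^⊥, where the orthogonal complement is taken with respect to the Euler pairing χ₀ on 𝒩(X). -/

import Mathlib

/-!
Formalization of Lemma 3.3 (`res` is well defined and injective): for a formal deformation
`𝒳 → Spf(ℂ[[t]])` of a smooth projective variety `X`, sending `[F] = [E_K] ∈ 𝒩(𝒳_K)` to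
`[E₀] ∈ 𝒩(X)` determines a well-defined injective linear map
`res : 𝒩(𝒳_K) → 𝒩(X)/ι^*K(𝒳)^⊥`.
-/

/-- Abstract K-theoretic data of a formal deformation `π : 𝒳 → Spf(R)` of a smooth projective
variety `X`: the K-groups `K(𝒳) = K(D^b(𝒳))`, `K(𝒳_K) = K(D^b(𝒳_K))` and `K(X) = K(D^b(X))`
together with the (surjective) projection `K(𝒳) → K(𝒳_K)`, the restriction
`[E] ↦ [E₀]` to the special fibre, and the Euler pairings `χ₀` and `χ_K`, satisfying
`χ₀(E₀,E'₀) = χ_K(E_K,E'_K)`. -/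
structure FormalDeformationKTheory where
  /-- `K(𝒳)`, the K-group of `D^b(𝒳)` -/
  KD : Type*
  [addKD : AddCommGroup KD]
  /-- `K(𝒳_K)`, the K-group of `D^b(𝒳_K)` -/
  KK : Type*
  [addKK : AddCommGroup KK]
  /-- `K(X)`, the K-group of `D^b(X)` -/
  K0 : Type*
  [addK0 : AddCommGroup K0]
  /-- the projection `K(𝒳) → K(𝒳_K)`, `[E] ↦ [E_K]` -/
  proj : KD →+ KK
  /-- `K(𝒳) → K(𝒳_K)` is surjective -/
  proj_surjective : Function.Surjective proj
  /-- the restriction to the special fibre, `[E] ↦ [E₀] = [Lι^*E]` -/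
  r0 : KD →+ K0
  /-- the Euler pairing `χ₀(E,E') = Σ(−1)ⁱ dim_ℂ Extⁱ_X(E,E')` on `K(X)` -/
  chi0 : K0 →+ K0 →+ ℤ
  /-- the Euler pairing `χ_K(F,F') = Σ(−1)ⁱ dim_K Extⁱ_{𝒳_K}(F,F')` on `K(𝒳_K)` -/
  chiK : KK →+ KK →+ ℤ
  /-- `χ₀(E₀,E'₀) = χ_K(E_K,E'_K)` for all `E, E' ∈ D^b(𝒳)` -/
  compat : ∀ a b : KD, chi0 (r0 a) (r0 b) = chiK (proj a) (proj b)

attribute [instance] FormalDeformationKTheory.addKD FormalDeformationKTheory.addKK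
  FormalDeformationKTheory.addK0

/-- The subgroup of numerically trivial classes of `K(𝒳_K)`: those pairing to zero with
everything under `χ_K`.  The numerical Grothendieck group is `𝒩(𝒳_K) = K(𝒳_K)/∼`. -/
def FormalDeformationKTheory.numTrivK (D : FormalDeformationKTheory) : AddSubgroup D.KK :=
  D.chiK.ker

/-- The preimage in `K(X)` of `ι^*K(𝒳)^⊥ ⊂ 𝒩(X)`: the classes orthogonal, with respect to
`χ₀`, to the image of `K(𝒳)` under restriction.  (It contains all numerically trivial classes,
so `𝒩(X)/ι^*K(𝒳)^⊥ = K(X)/orth`.) -/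
def FormalDeformationKTheory.orth (D : FormalDeformationKTheory) : AddSubgroup D.K0 :=
  AddMonoidHom.ker ((D.chi0.flip.comp D.r0).flip)

namespace FormalDeformationKTheory

/-- A class of `K(𝒳)` restricts into `ι^*K(𝒳)^⊥` exactly when its general fibre is numerically
trivial. -/
theorem r0_mem_orth_iff (D : FormalDeformationKTheory) (a : D.KD) :
    D.r0 a ∈ D.orth ↔ D.proj a ∈ D.numTrivK := by
  simp only [orth, numTrivK, AddMonoidHom.mem_ker, DFunLike.ext_iff, AddMonoidHom.flip_apply,
    AddMonoidHom.comp_apply, AddMonoidHom.zero_apply, D.compat, D.proj_surjective.forall]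

end FormalDeformationKTheory

/-- **Lemma**.  Sending `[F] = [E_K] ∈ 𝒩(𝒳_K)` (where `E ∈ D^b(𝒳)` is any lift of `F`) to
`[E₀] ∈ 𝒩(X)` determines a well-defined injective linear map
`res : 𝒩(𝒳_K) → 𝒩(X)/ι^*K(𝒳)^⊥`, the orthogonal complement being taken with respect to
`χ₀`. -/
theorem res_well_defined_and_injective (D : FormalDeformationKTheory) :
    ∃ res : (D.KK ⧸ D.numTrivK) →+ (D.K0 ⧸ D.orth),
      Function.Injective res ∧
      ∀ a : D.KD,
        res (QuotientAddGroup.mk (D.proj a)) = QuotientAddGroup.mk (D.r0 a) := by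
  have hp : Function.Surjective ((QuotientAddGroup.mk' D.numTrivK).comp D.proj) :=
    (QuotientAddGroup.mk'_surjective _).comp D.proj_surjective
  have hker : ∀ a, a ∈ ((QuotientAddGroup.mk' D.numTrivK).comp D.proj).ker ↔
      a ∈ ((QuotientAddGroup.mk' D.orth).comp D.r0).ker := fun a => by
    simp [AddMonoidHom.mem_ker, D.r0_mem_orth_iff]
  let res := AddMonoidHom.liftOfSurjective _ hp
    ⟨(QuotientAddGroup.mk' D.orth).comp D.r0, fun a => (hker a).1⟩
  have hres : ∀ a, res (QuotientAddGroup.mk (D.proj a)) = QuotientAddGroup.mk (D.r0 a) :=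
    AddMonoidHom.liftOfRightInverse_comp_apply _ _ (Function.rightInverse_surjInv hp)
      ⟨(QuotientAddGroup.mk' D.orth).comp D.r0, fun a => (hker a).1⟩
  refine ⟨res, (injective_iff_map_eq_zero res).2 fun x hx => ?_, hres⟩
  obtain ⟨a, rfl⟩ := hp x
  exact (hker a).2 ((hres a).symm.trans hx)
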